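/- Let A be a unital C*-algebra, let X be a complex Banach space, let ε > 0, and let F : A → X be Fréchet ℂ-differentiable on the open set H₊(A). If F vanishes on the set iε·1 + A_sa := {iε·1 + a : a ∈ A, a = a*}, then F vanishes identically on H₊(A). -/

import Mathlib

/-- The imaginary part `Im T := (T - T*)/(2i)` of an element of a C*-algebra. -/
noncomputable def cstarIm {A : Type*} [CStarAlgebra A] (T : A) : A :=
  ((2 * Complex.I)⁻¹ : ℂ) • (T - star T)

/-- The upper half-plane `H₊(A) = {T : Im T ≥ δ • 1 for some δ > 0}`. -/
def upperHalfPlaneCStar (A : Type*) [CStarAlgebra A] [PartialOrder A] : Set A :=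
  {T : A | ∃ δ : ℝ, 0 < δ ∧ δ • (1 : A) ≤ cstarIm T}

theorem cstarIm_eq_imaginaryPart {A : Type*} [CStarAlgebra A] (T : A) :
    cstarIm T = (imaginaryPart T : A) := by
  rw [imaginaryPart_apply_coe, cstarIm, ← Complex.coe_smul, smul_smul]
  congr 1
  rw [mul_inv, Complex.inv_I]
  push_cast
  ring

theorem convex_upperHalfPlaneCStar (A : Type*) [CStarAlgebra A] [PartialOrder A]
    [StarOrderedRing A] : Convex ℝ (upperHalfPlaneCStar A) := by
  rintro S ⟨δ, hδ, hS⟩ T ⟨γ, hγ, hT⟩ a b ha hb hab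
  refine ⟨a * δ + b * γ, ?_, ?_⟩
  · rcases ha.eq_or_lt with rfl | ha'
    · obtain rfl : b = 1 := by linarith
      simpa using hγ
    · positivity
  · rw [cstarIm_eq_imaginaryPart] at hS hT ⊢
    simp only [map_add, map_smul, AddSubgroup.coe_add, selfAdjoint.val_smul, add_smul, mul_smul]
    gcongr

theorem isOpen_upperHalfPlaneCStar (A : Type*) [CStarAlgebra A] [PartialOrder A]
    [StarOrderedRing A] : IsOpen (upperHalfPlaneCStar A) := by
  refine Metric.isOpen_iff.mpr fun T ⟨δ, hδ, hT⟩ => ⟨δ, hδ, fun S hS => ?_⟩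
  rw [mem_ball_iff_norm] at hS
  refine ⟨δ - ‖S - T‖, sub_pos.mpr hS, ?_⟩
  rw [cstarIm_eq_imaginaryPart] at hT ⊢
  have hnorm : ‖(imaginaryPart (S - T) : A)‖ ≤ ‖S - T‖ := by
    simpa using! imaginaryPart.norm_le (S - T)
  have hlow : -(‖S - T‖ • (1 : A)) ≤ (imaginaryPart (S - T) : A) := by
    refine le_trans (neg_le_neg ?_)
      (IsSelfAdjoint.neg_algebraMap_norm_le_self (imaginaryPart (S - T)).2)
    rw [Algebra.algebraMap_eq_smul_one]
    exact smul_le_smul_of_nonneg_right hnorm zero_le_one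
  calc (δ - ‖S - T‖) • (1 : A) = δ • (1 : A) + -(‖S - T‖ • (1 : A)) := by
        rw [sub_smul, sub_eq_add_neg]
    _ ≤ (imaginaryPart T : A) + (imaginaryPart (S - T) : A) := add_le_add hT hlow
    _ = (imaginaryPart S : A) := by simp

/-- `iε·1 + A_sa` is a uniqueness set for holomorphic functions on `H₊(A)`
(used in the proofs of Propositions 3.2 and 3.3 of the paper): a Banach-space
valued function, holomorphic on `H₊(A)` and vanishing on `iε·1 + A_sa`,
vanishes identically on `H₊(A)`. -/
theorem eqOn_zero_of_holomorphic_vanishing_on_shifted_selfAdjoint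
    {A : Type*} [CStarAlgebra A] [PartialOrder A] [StarOrderedRing A] [Nontrivial A]
    {X : Type*} [NormedAddCommGroup X] [NormedSpace ℂ X]
    (ε : ℝ) (hε : 0 < ε) (F : A → X)
    (hF : DifferentiableOn ℂ F (upperHalfPlaneCStar A))
    (hvan : ∀ a : A, IsSelfAdjoint a →
      F (((ε : ℂ) * Complex.I) • (1 : A) + a) = 0) :
    ∀ T ∈ upperHalfPlaneCStar A, F T = 0 := by
  intro T hT
  have hone : cstarIm (((ε : ℂ) * Complex.I) • (1 : A)) = ε • 1 := by
    rw [cstarIm, star_smul, star_one, ← sub_smul, smul_smul, ← Complex.coe_smul]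
    congr 1
    simp only [star_mul', RCLike.star_def, Complex.conj_ofReal, Complex.conj_I]
    field_simp [Complex.I_ne_zero]
    ring
  set x : A := (realPart T : A)
  set y : A := (imaginaryPart T : A)
  have hx : IsSelfAdjoint x := (realPart T).2
  have hy : IsSelfAdjoint y := (imaginaryPart T).2
  have hxy : x + Complex.I • y = T := realPart_add_I_smul_imaginaryPart T
  let g : ℂ → A := fun z => ((ε : ℂ) * Complex.I) • (1 : A) + x + z • (y - ε • 1)
  have hg : Differentiable ℂ g := by fun_prop
  have hgI : g Complex.I = T := by
    rw [← hxy]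
    simp only [g, ← Complex.coe_smul]
    module
  have hgreal (r : ℝ) : F (g r) = 0 := by
    have hsa : IsSelfAdjoint (x + r • (y - ε • (1 : A))) :=
      hx.add ((IsSelfAdjoint.all r).smul (hy.sub ((IsSelfAdjoint.all ε).smul (.one A))))
    simpa only [g, add_assoc, Complex.coe_smul] using hvan _ hsa
  let U : Set ℂ := g ⁻¹' upperHalfPlaneCStar A
  have hUopen : IsOpen U := (isOpen_upperHalfPlaneCStar A).preimage hg.continuous
  have hUconv : Convex ℝ U := by
    intro z hz w hw a b ha hb hab
    have hmem := convex_upperHalfPlaneCStar A hz hw ha hb hab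
    obtain rfl : b = 1 - a := by linarith
    suffices heq : g (a • z + (1 - a) • w) = a • g z + (1 - a) • g w by
      simpa only [U, Set.mem_preimage, heq] using hmem
    simp only [g, ← Complex.coe_smul]
    push_cast
    module
  have hU0 : (0 : ℂ) ∈ U := by
    refine ⟨ε, hε, ?_⟩
    simp [g, cstarIm_eq_imaginaryPart, hx.imaginaryPart, ← hone]
  have hUI : Complex.I ∈ U := by simpa only [U, Set.mem_preimage, hgI] using hT
  refine SeparatingDual.eq_zero_of_forall_dual_eq_zero (R := ℂ) fun φ => ?_
  have hf : DifferentiableOn ℂ (fun z => φ (F (g z))) U :=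
    φ.differentiable.comp_differentiableOn (hF.comp hg.differentiableOn fun _ hz => hz)
  have hfreq : ∃ᶠ z in nhdsWithin (0 : ℂ) {0}ᶜ, φ (F (g z)) = 0 := by
    have htend : Filter.Tendsto ((↑) : ℝ → ℂ) (nhdsWithin 0 {0}ᶜ) (nhdsWithin 0 {0}ᶜ) := by
      simpa using Complex.continuous_ofReal.continuousAt.continuousWithinAt.tendsto_nhdsWithin
        (s := {0}ᶜ) (t := {0}ᶜ) (x := 0) (fun r hr => by simpa using hr)
    refine htend.frequently (Filter.Eventually.frequently (.of_forall fun r => ?_))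
    rw [hgreal, map_zero]
  have hzero := (hf.analyticOnNhd hUopen).eqOn_zero_of_preconnected_of_frequently_eq_zero
    hUconv.isPreconnected hU0 hfreq hUI
  simpa only [hgI, Pi.zero_apply] using hzero
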